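/- arXiv:math/0611527 — 2 statements merged into one kernel-verified Lean document; each statement's English description precedes it below -/
import Mathlib

section
/- Let Π be a polar space of rank n ≥ 3. Every bijective transformation f of the point set P such that, for all points p, q, p and q are collinear if and only if f(p) and f(q) are collinear, is a collineation of Π. -/
/- Common framework: polar spaces of rank `n`, singular subspaces, projective
dimension, Grassmannians, bases and base subsets, inexact/complement subsets,
following Pankov, "Base subsets of polar Grassmannians". -/

namespace PolarGeo

variable {P : Type*}

/-- The (reflexive) collinearity relation determined by a family of lines. -/
def Col (lines : Set (Set P)) (p q : P) : Prop :=
  p = q ∨ ∃ L ∈ lines, p ∈ L ∧ q ∈ L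

/-- `S` is a subspace: it contains every line through two of its distinct
collinear points. -/
def IsSubspace (lines : Set (Set P)) (S : Set P) : Prop :=
  ∀ p ∈ S, ∀ q ∈ S, p ≠ q → ∀ L ∈ lines, p ∈ L → q ∈ L → L ⊆ S

/-- A singular subspace: a subspace whose points are mutually collinear. -/
def IsSingular (lines : Set (Set P)) (S : Set P) : Prop :=
  IsSubspace lines S ∧ ∀ p ∈ S, ∀ q ∈ S, Col lines p q

/-- A flag: a chain of nonempty singular subspaces. -/
def IsFlag (lines : Set (Set P)) (C : Set (Set P)) : Prop :=
  IsChain (· ⊆ ·) C ∧ ∀ T ∈ C, IsSingular lines T ∧ T.Nonempty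

/-- A polar space of rank `n` on the point set `P`: a partial linear space
such that every point is collinear with one or all points of every line, no
point is collinear with all others, and every maximal flag of singular
subspaces consists of `n` elements. -/
structure PolarSpace (P : Type*) (n : ℕ) where
  lines : Set (Set P)
  line_proper : ∀ L ∈ lines, L ≠ (Set.univ : Set P)
  line_two : ∀ L ∈ lines, ∃ p ∈ L, ∃ q ∈ L, p ≠ q
  point_on_line : ∀ p : P, ∃ L ∈ lines, p ∈ L
  unique_line : ∀ p q : P, p ≠ q → ∀ L₁ ∈ lines, ∀ L₂ ∈ lines,
    p ∈ L₁ → q ∈ L₁ → p ∈ L₂ → q ∈ L₂ → L₁ = L₂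
  one_or_all : ∀ p : P, ∀ L ∈ lines,
    (∃! q, q ∈ L ∧ Col lines p q) ∨ ∀ q ∈ L, Col lines p q
  no_center : ∀ p : P, ∃ q : P, ¬ Col lines p q
  flag_card : ∀ C : Set (Set P), IsFlag lines C →
    (∀ C', IsFlag lines C' → C ⊆ C' → C = C') → C.ncard = n

/-- A flag all of whose members are contained in `S`. -/
def IsFlagIn (lines : Set (Set P)) (S : Set P) (C : Set (Set P)) : Prop :=
  IsFlag lines C ∧ ∀ T ∈ C, T ⊆ S

/-- `S` is a singular subspace of projective dimension `m` (so `dim ∅ = -1`):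
a maximal chain of nonempty singular subspaces contained in `S` has `m + 1`
members. -/
def HasDim (lines : Set (Set P)) (S : Set P) (m : ℤ) : Prop :=
  IsSingular lines S ∧ ∃ C : Set (Set P), IsFlagIn lines S C ∧
    (∀ C', IsFlagIn lines S C' → C ⊆ C' → C = C') ∧
    C.Finite ∧ (C.ncard : ℤ) = m + 1

/-- The Grassmannian `G_m` of `m`-dimensional singular subspaces. -/
def Gdim (lines : Set (Set P)) (m : ℤ) : Set (Set P) := {S | HasDim lines S m}

/-- The span of `X`: the smallest subspace containing `X`. -/
def span (lines : Set (Set P)) (X : Set P) : Set P :=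
  ⋂₀ {S : Set P | IsSubspace lines S ∧ X ⊆ S}

/-- `X ⊥`: the set of points collinear with every point of `X`. -/
def perp (lines : Set (Set P)) (X : Set P) : Set P :=
  {y | ∀ x ∈ X, Col lines x y}

/-- A base of the polar space: `2n` points each of which is non-collinear
with exactly one of them. -/
def IsBase (lines : Set (Set P)) {n : ℕ} (p : Fin (2 * n) → P) : Prop :=
  Function.Injective p ∧ ∀ i, ∃! j, ¬ Col lines (p i) (p j)

/-- The base subset of `G_k` associated with a base: all `k`-dimensional
singular subspaces spanned by points of the base. -/
def baseSubset (lines : Set (Set P)) {n : ℕ} (p : Fin (2 * n) → P) (k : ℤ) :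
    Set (Set P) :=
  {S | HasDim lines S k ∧ ∃ I : Set (Fin (2 * n)), S = span lines (p '' I)}

/-- `𝓑(+x)`: the elements of `𝓑` containing the point `x`. -/
def plus (𝓑 : Set (Set P)) (x : P) : Set (Set P) := {S ∈ 𝓑 | x ∈ S}

/-- `𝓑(-x)`: the elements of `𝓑` not containing the point `x`. -/
def minus (𝓑 : Set (Set P)) (x : P) : Set (Set P) := {S ∈ 𝓑 | x ∉ S}

/-- `R ⊆ 𝓑` is inexact: some base subset of `G_k` different from `𝓑`
contains `R`. -/
def IsInexact (lines : Set (Set P)) (n : ℕ) (k : ℤ) (𝓑 R : Set (Set P)) : Prop :=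
  R ⊆ 𝓑 ∧ ∃ p' : Fin (2 * n) → P, IsBase lines p' ∧
    R ⊆ baseSubset lines p' k ∧ baseSubset lines p' k ≠ 𝓑

/-- `R ⊆ 𝓑` is exact: `𝓑` is the only base subset of `G_k` containing `R`. -/
def IsExact (lines : Set (Set P)) (n : ℕ) (k : ℤ) (𝓑 R : Set (Set P)) : Prop :=
  R ⊆ 𝓑 ∧ ∀ p' : Fin (2 * n) → P, IsBase lines p' →
    R ⊆ baseSubset lines p' k → baseSubset lines p' k = 𝓑

/-- A maximal inexact subset of `𝓑`. -/
def IsMaxInexact (lines : Set (Set P)) (n : ℕ) (k : ℤ) (𝓑 R : Set (Set P)) : Prop :=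
  IsInexact lines n k 𝓑 R ∧ ∀ R', IsInexact lines n k 𝓑 R' → R ⊆ R' → R = R'

/-- A complement subset of `𝓑`: the complement of a maximal inexact subset. -/
def IsComplement (lines : Set (Set P)) (n : ℕ) (k : ℤ) (𝓑 R : Set (Set P)) : Prop :=
  R ⊆ 𝓑 ∧ IsMaxInexact lines n k 𝓑 (𝓑 \ R)

/-- Type `C`: every `(n-2)`-dimensional singular subspace is contained in at
least `3` maximal singular subspaces. -/
def TypeC (lines : Set (Set P)) (n : ℕ) : Prop :=
  ∀ S ∈ Gdim lines ((n : ℤ) - 2), ∃ M₁ ∈ Gdim lines ((n : ℤ) - 1),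
    ∃ M₂ ∈ Gdim lines ((n : ℤ) - 1), ∃ M₃ ∈ Gdim lines ((n : ℤ) - 1),
      M₁ ≠ M₂ ∧ M₁ ≠ M₃ ∧ M₂ ≠ M₃ ∧ S ⊆ M₁ ∧ S ⊆ M₂ ∧ S ⊆ M₃

/-- Type `D`: every `(n-2)`-dimensional singular subspace is contained in
exactly `2` maximal singular subspaces. -/
def TypeD (lines : Set (Set P)) (n : ℕ) : Prop :=
  ∀ S ∈ Gdim lines ((n : ℤ) - 2),
    {M | M ∈ Gdim lines ((n : ℤ) - 1) ∧ S ⊆ M}.ncard = 2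

/-- A collineation of a point-line geometry on the whole type: a bijection
preserving the family of lines in both directions. -/
def IsCollineation (lines : Set (Set P)) (f : P → P) : Prop :=
  Function.Bijective f ∧ ∀ L : Set P, L ∈ lines ↔ f '' L ∈ lines

/-- A collineation of a partial linear space whose point set is the subset
`pts` of `X`: a bijection of `pts` mapping the family of lines onto itself in
both directions. -/
def IsCollineationOn {X : Type*} (pts : Set X) (lns : Set (Set X)) (f : X → X) : Prop :=
  Set.BijOn f pts pts ∧ (∀ ℓ ∈ lns, f '' ℓ ∈ lns) ∧
    (∀ ℓ ∈ lns, ∃ ℓ' ∈ lns, f '' ℓ' = ℓ)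

/-- Lines of the Grassmann space `𝔊_k`. For `k ≤ n - 2` a line is given by
incident `S ∈ G_{k-1}`, `U ∈ G_{k+1}` (for `k = 0` this is the shadow of an
element of `G_1`); for `k = n - 1` a line is given by an element of
`G_{n-2}`. -/
def grassLines (lines : Set (Set P)) (n k : ℕ) : Set (Set (Set P)) :=
  if k = n - 1 then
    {ℓ | ∃ S ∈ Gdim lines ((n : ℤ) - 2),
      ℓ = {T | T ∈ Gdim lines ((n : ℤ) - 1) ∧ S ⊆ T}}
  else
    {ℓ | ∃ S ∈ Gdim lines ((k : ℤ) - 1), ∃ U ∈ Gdim lines ((k : ℤ) + 1),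
      S ⊆ U ∧ ℓ = {T | T ∈ Gdim lines (k : ℤ) ∧ S ⊆ T ∧ T ⊆ U}}

/-- Collinearity of distinct points of `𝔊_k` for `k ≤ n - 2`: `S ⊥ U` and
the span of `S ∪ U` is `(k+1)`-dimensional. -/
def GColl (lines : Set (Set P)) (k : ℤ) (S U : Set P) : Prop :=
  S ≠ U ∧ (∀ a ∈ S, ∀ b ∈ U, Col lines a b) ∧
    span lines (S ∪ U) ∈ Gdim lines (k + 1)

/-- Weak adjacency in `G_k`: the intersection is `(k-1)`-dimensional. -/
def WeakAdj (lines : Set (Set P)) (k : ℤ) (S U : Set P) : Prop :=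
  S ∩ U ∈ Gdim lines (k - 1)

/-- The complement subset `C_{ij} = 𝓑(+i,-j) ∪ 𝓑(+σ(j),-σ(i))` of second
type. -/
def Cij (lines : Set (Set P)) {n : ℕ} (p : Fin (2 * n) → P)
    (σ : Fin (2 * n) → Fin (2 * n)) (k : ℤ) (i j : Fin (2 * n)) : Set (Set P) :=
  (plus (baseSubset lines p k) (p i) ∩ minus (baseSubset lines p k) (p j)) ∪
  (plus (baseSubset lines p k) (p (σ j)) ∩ minus (baseSubset lines p k) (p (σ i)))

/-- The inexact subset
`R_{ij} = 𝓑(+i,+j) ∪ 𝓑(+σ(i),+σ(j)) ∪ 𝓑(-i,-σ(j))` of second type. -/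
def Rij (lines : Set (Set P)) {n : ℕ} (p : Fin (2 * n) → P)
    (σ : Fin (2 * n) → Fin (2 * n)) (k : ℤ) (i j : Fin (2 * n)) : Set (Set P) :=
  (plus (baseSubset lines p k) (p i) ∩ plus (baseSubset lines p k) (p j)) ∪
  (plus (baseSubset lines p k) (p (σ i)) ∩ plus (baseSubset lines p k) (p (σ j))) ∪
  (minus (baseSubset lines p k) (p i) ∩ minus (baseSubset lines p k) (p (σ j)))

/-- `c(S,U)`: the number of complement subsets of second type of the base
subset containing both `S` and `U`. -/
noncomputable def cCount (lines : Set (Set P)) {n : ℕ} (p : Fin (2 * n) → P)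
    (σ : Fin (2 * n) → Fin (2 * n)) (k : ℤ) (S U : Set P) : ℕ :=
  {R : Set (Set P) | (∃ i j, j ≠ i ∧ j ≠ σ i ∧ R = Cij lines p σ k i j) ∧
    S ∈ R ∧ U ∈ R}.ncard

/-- `O_+`, `O_-` form the half-spin partition of `G_{n-1}`: two maximal
singular subspaces lie in the same class iff `n - dim (S ∩ U)` is odd. -/
def IsHalfSpinPair (lines : Set (Set P)) (n : ℕ) (Opos Oneg : Set (Set P)) : Prop :=
  Opos.Nonempty ∧ Oneg.Nonempty ∧ Disjoint Opos Oneg ∧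
  Opos ∪ Oneg = Gdim lines ((n : ℤ) - 1) ∧
  ∀ S ∈ Gdim lines ((n : ℤ) - 1), ∀ U ∈ Gdim lines ((n : ℤ) - 1),
    ((S ∈ Opos ↔ U ∈ Opos) ↔ ∃ m : ℤ, HasDim lines (S ∩ U) m ∧ Odd ((n : ℤ) - m))

/-- The base subset of `O_δ` associated with a base. -/
def baseSubsetO (lines : Set (Set P)) (n : ℕ) (Oδ : Set (Set P))
    (p : Fin (2 * n) → P) : Set (Set P) :=
  Oδ ∩ baseSubset lines p ((n : ℤ) - 1)

/-- `R ⊆ 𝓑` is inexact in `O_δ`: some base subset of `O_δ` different from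
`𝓑` contains `R`. -/
def IsInexactO (lines : Set (Set P)) (n : ℕ) (Oδ : Set (Set P))
    (𝓑 R : Set (Set P)) : Prop :=
  R ⊆ 𝓑 ∧ ∃ p' : Fin (2 * n) → P, IsBase lines p' ∧
    R ⊆ baseSubsetO lines n Oδ p' ∧ baseSubsetO lines n Oδ p' ≠ 𝓑

/-- A maximal inexact subset of a base subset `𝓑` of `O_δ`. -/
def IsMaxInexactO (lines : Set (Set P)) (n : ℕ) (Oδ : Set (Set P))
    (𝓑 R : Set (Set P)) : Prop :=
  IsInexactO lines n Oδ 𝓑 R ∧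
    ∀ R', IsInexactO lines n Oδ 𝓑 R' → R ⊆ R' → R = R'

/-- A complement subset of a base subset `𝓑` of `O_δ`. -/
def IsComplementO (lines : Set (Set P)) (n : ℕ) (Oδ : Set (Set P))
    (𝓑 R : Set (Set P)) : Prop :=
  R ⊆ 𝓑 ∧ IsMaxInexactO lines n Oδ 𝓑 (𝓑 \ R)

/-- Lines of the half-spin space `𝔒_δ`: sets of all elements of `O_δ`
containing a fixed `(n-3)`-dimensional singular subspace. -/
def halfSpinLines (lines : Set (Set P)) (n : ℕ) (Oδ : Set (Set P)) :
    Set (Set (Set P)) :=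
  {ℓ | ∃ S ∈ Gdim lines ((n : ℤ) - 3), ℓ = {T | T ∈ Oδ ∧ S ⊆ T}}

end PolarGeo

open PolarGeo

namespace PolarGeo

variable {P : Type*} {n : ℕ}

theorem Col.symm' {l : Set (Set P)} {p q : P} (h : Col l p q) : Col l q p := by
  rcases h with h | ⟨L, hL, h1, h2⟩
  · exact Or.inl h.symm
  · exact Or.inr ⟨L, hL, h2, h1⟩

theorem PolarSpace.meet (S : PolarSpace P n) (p : P) {L : Set P} (hL : L ∈ S.lines) :
    ∃ q ∈ L, Col S.lines p q := by
  rcases S.one_or_all p L hL with ⟨q, hq, _⟩ | h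
  · exact ⟨q, hq.1, hq.2⟩
  · obtain ⟨a, ha, _⟩ := S.line_two L hL
    exact ⟨a, ha, h a ha⟩

theorem PolarSpace.two_all (S : PolarSpace P n) {p : P} {L : Set P} (hL : L ∈ S.lines)
    {a b : P} (ha : a ∈ L) (hb : b ∈ L) (hab : a ≠ b) (h1 : Col S.lines p a)
    (h2 : Col S.lines p b) {c : P} (hc : c ∈ L) : Col S.lines p c := by
  rcases S.one_or_all p L hL with ⟨q, _, hu⟩ | h
  · exact absurd ((hu a ⟨ha, h1⟩).trans (hu b ⟨hb, h2⟩).symm) hab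
  · exact h c hc

/-- If every point of `Q` collinear with `p` is collinear with `z`, and `z` is collinear
with `p`, then a point of `Q` noncollinear with `p` ... the line argument. -/
theorem PolarSpace.perp_le (S : PolarSpace P n) {Q : Set P} (hQ : IsSubspace S.lines Q)
    {p y z : P} (hy : y ∈ Q) (hpy : ¬ Col S.lines p y) (hyz : Col S.lines z y)
    (h : ∀ w ∈ Q, Col S.lines p w → Col S.lines y w → Col S.lines z w) :
    ∀ w ∈ Q, Col S.lines y w → Col S.lines z w := by
  intro w hw hyw
  rcases hyw with rfl | ⟨K, hK, hyK, hwK⟩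
  · exact hyz
  · by_cases hne : y = w
    · subst hne; exact hyz
    have hKQ := hQ y hy w hw hne K hK hyK hwK
    obtain ⟨v, hv, hpv⟩ := S.meet p hK
    have hvy : y ≠ v := by rintro rfl; exact hpy hpv
    exact S.two_all hK hyK hv hvy hyz (h v (hKQ hv) hpv (Or.inr ⟨K, hK, hyK, hv⟩)) hwK

theorem PolarSpace.separate (S : PolarSpace P n) {Q : Set P} (hQ : IsSubspace S.lines Q)
    (hnc : ∀ p ∈ Q, ∃ q ∈ Q, ¬ Col S.lines p q) {p q : P} (hp : p ∈ Q) (hq : q ∈ Q)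
    (hpq : p ≠ q) : ∃ x ∈ Q, Col S.lines p x ∧ ¬ Col S.lines q x := by
  by_contra! hcon
  have hcpq : Col S.lines p q := (hcon p hp (Or.inl rfl)).symm'
  obtain ⟨L, hL, hpL, hqL⟩ := hcpq.resolve_left hpq
  have hLQ := hQ p hp q hq hpq L hL hpL hqL
  obtain ⟨y, hy, hqy⟩ := hnc q hq
  have hpy : ¬ Col S.lines p y := fun h => hqy (hcon y hy h)
  obtain ⟨z, hz, hyz⟩ := S.meet y hL
  have hzQ := hLQ hz
  have hpz : p ≠ z := by rintro rfl; exact hpy hyz.symm'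
  have hzp : ∀ w ∈ Q, Col S.lines p w → Col S.lines z w := fun w hw h =>
    (S.two_all hL hpL hqL hpq h.symm' (hcon w hw h).symm' hz).symm'
  obtain ⟨t, ht, hzt⟩ := hnc z hzQ
  have hyne : y ≠ z := by
    rintro rfl; exact hpy (Or.inr ⟨L, hL, hpL, hz⟩)
  obtain ⟨K, hK, hyK, hzK⟩ := hyz.resolve_left hyne
  obtain ⟨v, hv, htv⟩ := S.meet t hK
  have hvQ := hQ y hy z hzQ hyne K hK hyK hzK hv
  have hvz : v ≠ z := by rintro rfl; exact hzt htv.symm'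
  have hpv : ¬ Col S.lines p v := fun h =>
    hpy (S.two_all hK hv hzK hvz h (Or.inr ⟨L, hL, hpL, hz⟩) hyK)
  exact hzt (S.perp_le hQ hvQ hpv (Or.inr ⟨K, hK, hzK, hv⟩)
    (fun w hw h _ => hzp w hw h) t ht htv.symm')

theorem PolarSpace.line_eq (S : PolarSpace P n) {L : Set P} (hL : L ∈ S.lines) {p q : P}
    (hp : p ∈ L) (hq : q ∈ L) (hpq : p ≠ q) :
    L = {r | ∀ x, Col S.lines x p → Col S.lines x q → Col S.lines x r} := by
  ext r
  refine ⟨fun hr x h1 h2 => S.two_all hL hp hq hpq h1 h2 hr, fun h => ?_⟩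
  by_contra hrL
  have hpr : Col S.lines p r := h p (Or.inl rfl) (Or.inr ⟨L, hL, hp, hq⟩)
  have hne : p ≠ r := by rintro rfl; exact hrL hp
  obtain ⟨M, hM, hpM, hrM⟩ := hpr.resolve_left hne
  obtain ⟨y, hpy⟩ := S.no_center p
  have hU : IsSubspace S.lines (Set.univ : Set P) := fun _ _ _ _ _ _ _ _ _ => Set.subset_univ _
  let Q : Set P := {x | Col S.lines p x ∧ Col S.lines y x}
  have hQ : IsSubspace S.lines Q := fun a ha b hb hab K hK haK hbK c hc =>
    ⟨S.two_all hK haK hbK hab ha.1 hb.1 hc, S.two_all hK haK hbK hab ha.2 hb.2 hc⟩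
  have hnc : ∀ c ∈ Q, ∃ d ∈ Q, ¬ Col S.lines c d := by
    intro c hc
    by_contra! hcon
    have hcp : p ≠ c := by rintro rfl; exact hpy hc.2.symm'
    obtain ⟨x, _, hx1, hx2⟩ := S.separate hU
      (fun a _ => (S.no_center a).imp fun b hb => ⟨trivial, hb⟩) (p := p) (q := c)
      trivial trivial hcp
    exact hx2 (S.perp_le hU (p := y) (y := p) trivial (fun h => hpy h.symm') hc.1.symm'
      (fun w _ h1 h2 => hcon w ⟨h2, h1⟩) x trivial hx1)
  obtain ⟨a, haL, hya⟩ := S.meet y hL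
  obtain ⟨b, hbM, hyb⟩ := S.meet y hM
  have hpa : p ≠ a := by rintro rfl; exact hpy hya.symm'
  have hpb : p ≠ b := by rintro rfl; exact hpy hyb.symm'
  have hab : a ≠ b := by
    rintro rfl
    exact hrL (S.unique_line p a hpa L hL M hM hp haL hpM hbM ▸ hrM)
  obtain ⟨x, hxQ, hxa, hxb⟩ := S.separate hQ hnc (p := a) (q := b)
    ⟨Or.inr ⟨L, hL, hp, haL⟩, hya⟩ ⟨Or.inr ⟨M, hM, hpM, hbM⟩, hyb⟩ hab
  have hxp := hxQ.1.symm'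
  have hxr := h x hxp (S.two_all hL hp haL hpa hxp hxa.symm' hq)
  exact hxb (S.two_all hM hpM hrM hne hxp hxr hbM).symm'

theorem PolarSpace.image_line (S : PolarSpace P n) (f : P → P) (hbij : Function.Bijective f)
    (hcol : ∀ p q : P, Col S.lines p q ↔ Col S.lines (f p) (f q)) {L : Set P}
    (hL : L ∈ S.lines) : f '' L ∈ S.lines := by
  obtain ⟨p, hp, q, hq, hpq⟩ := S.line_two L hL
  have hne : f p ≠ f q := fun h => hpq (hbij.1 h)
  obtain ⟨M, hM, hpM, hqM⟩ := ((hcol p q).1 (Or.inr ⟨L, hL, hp, hq⟩)).resolve_left hne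
  have key : f '' L = M := by
    ext s
    obtain ⟨r, rfl⟩ := hbij.2 s
    rw [hbij.1.mem_set_image, S.line_eq hL hp hq hpq, S.line_eq hM hpM hqM hne]
    constructor
    · intro h x
      obtain ⟨x, rfl⟩ := hbij.2 x
      rw [← hcol, ← hcol, ← hcol]
      exact h x
    · intro h x
      rw [hcol, hcol x, hcol x]
      exact h (f x)
  rw [key]; exact hM

end PolarGeo

/-- Fact 1: every bijective transformation of `P` preserving the collinearity
relation in both directions is a collineation of `Π`. -/
theorem collinearity_preserving_is_collineation
    {P : Type*} {n : ℕ} (Pol : PolarSpace P n) (hn : 3 ≤ n)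
    (f : P → P) (hbij : Function.Bijective f)
    (hcol : ∀ p q : P, Col Pol.lines p q ↔ Col Pol.lines (f p) (f q)) :
    IsCollineation Pol.lines f := by
  refine ⟨hbij, fun L => ⟨fun h => Pol.image_line f hbij hcol h, fun h => ?_⟩⟩
  obtain ⟨g, hgf, hfg⟩ := Function.bijective_iff_has_inverse.1 hbij
  have h2 := Pol.image_line g ⟨hfg.injective, hgf.surjective⟩
    (fun p q => by rw [hcol (g p) (g q), hfg p, hfg q]) h
  rwa [Set.image_image, Set.image_congr (fun a _ => hgf a), Set.image_id'] at h2
end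

section
/- Let Π be a polar space of rank n ≥ 3 of type C or of type D, 1 ≤ k ≤ n−2, B a base of Π and 𝓑 the associated base subset of G_k. Distinct S, U ∈ 𝓑 are collinear points of 𝔊_k if and only if c(S,U) = m_c, where m_c := max{ c(S,U) : S, U ∈ 𝓑, S ≠ U }. -/
open PolarGeo

section Helpers

variable {P : Type*} {n : ℕ}

theorem aux_col_symm {l : Set (Set P)} {a b : P} (h : Col l a b) : Col l b a := by
  rcases h with h | ⟨L, hL, h1, h2⟩
  · exact Or.inl h.symm
  · exact Or.inr ⟨L, hL, h2, h1⟩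

theorem aux_subset_span (l : Set (Set P)) (X : Set P) : X ⊆ span l X :=
  fun _ hx _ hS => hS.2 hx

theorem aux_span_le {l : Set (Set P)} {X S : Set P} (hS : IsSubspace l S) (h : X ⊆ S) :
    span l X ⊆ S := fun _ hx => hx S ⟨hS, h⟩

theorem aux_span_subspace (l : Set (Set P)) (X : Set P) : IsSubspace l (span l X) := by
  intro a ha b hb hab L hL haL hbL y hy S hS
  exact hS.1 a (ha S hS) b (hb S hS) hab L hL haL hbL hy

theorem aux_span_mono (l : Set (Set P)) {X Y : Set P} (h : X ⊆ Y) : span l X ⊆ span l Y :=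
  aux_span_le (aux_span_subspace l Y) (h.trans (aux_subset_span l Y))

/-- The perp of a point is a subspace. -/
theorem aux_perp_subspace (Pol : PolarSpace P n) (x : P) :
    IsSubspace Pol.lines {y | Col Pol.lines x y} := by
  intro a ha b hb hab L hL haL hbL y hy
  rcases Pol.one_or_all x L hL with ⟨q, -, hq⟩ | h
  · exact absurd ((hq a ⟨haL, ha⟩).trans (hq b ⟨hbL, hb⟩).symm) hab
  · exact h y hy

theorem aux_span_singular (Pol : PolarSpace P n) {X : Set P}
    (h : ∀ a ∈ X, ∀ b ∈ X, Col Pol.lines a b) : IsSingular Pol.lines (span Pol.lines X) := by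
  refine ⟨aux_span_subspace _ _, ?_⟩
  have h1 : ∀ a ∈ X, ∀ b ∈ span Pol.lines X, Col Pol.lines a b := fun a ha =>
    aux_span_le (aux_perp_subspace Pol a) (fun b hb => h a ha b hb)
  intro a ha
  exact aux_span_le (aux_perp_subspace Pol a) (fun b hb => aux_col_symm (h1 b hb a ha))

/-- Chains of members of `Q` extend to maximal ones. -/
theorem aux_zorn (Q : Set P → Prop) (C : Set (Set P)) (hC : IsChain (· ⊆ ·) C)
    (hQ : ∀ T ∈ C, Q T) :
    ∃ D, C ⊆ D ∧ IsChain (· ⊆ ·) D ∧ (∀ T ∈ D, Q T) ∧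
      ∀ D', IsChain (· ⊆ ·) D' → (∀ T ∈ D', Q T) → D ⊆ D' → D = D' := by
  obtain ⟨D, hCD, hD⟩ := zorn_subset_nonempty
    {D : Set (Set P) | IsChain (· ⊆ ·) D ∧ ∀ T ∈ D, Q T} (by
      intro c hc hchain hne
      refine ⟨⋃₀ c, ⟨?_, ?_⟩, fun s hs => Set.subset_sUnion_of_mem hs⟩
      · intro a ha b hb hab
        obtain ⟨s, hs, has⟩ := ha
        obtain ⟨t, ht, hbt⟩ := hb
        rcases hchain.total hs ht with h | h
        · exact (hc ht).1 (h has) hbt hab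
        · exact (hc hs).1 has (h hbt) hab
      · rintro T ⟨s, hs, hT⟩
        exact (hc hs).2 T hT) C ⟨hC, hQ⟩
  refine ⟨D, hCD, hD.prop.1, hD.prop.2, fun D' h1 h2 h3 => ?_⟩
  exact h3.antisymm (hD.le_of_ge ⟨h1, h2⟩ h3)

theorem aux_insert_chain {C : Set (Set P)} {T : Set P} (hC : IsChain (· ⊆ ·) C)
    (h : ∀ A ∈ C, T ⊆ A ∨ A ⊆ T) : IsChain (· ⊆ ·) (insert T C) :=
  hC.insert (fun A hA _ => h A hA)

/-- Maximal flags inside a singular subspace are complemented to `n` uniformly. -/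
theorem aux_flag_compl (Pol : PolarSpace P n) (hn : 0 < n) (S : Set P) :
    ∃ u : ℕ, ∀ C, IsFlagIn Pol.lines S C → IsSingular Pol.lines S →
      (∀ C', IsFlagIn Pol.lines S C' → C ⊆ C' → C = C') → C.Finite ∧ C.ncard + u = n := by
  obtain ⟨E, -, hE1, hE2, hE3⟩ := aux_zorn
    (fun T => (IsSingular Pol.lines T ∧ T.Nonempty) ∧ S ⊂ T) ∅ (by simp [IsChain]) (by simp)
  refine ⟨E.ncard, fun C hC hS hmax => ?_⟩
  have hSC : S.Nonempty → S ∈ C := by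
    intro hne
    have := hmax (insert S C) ⟨⟨aux_insert_chain hC.1.1 (fun A hA => Or.inr (hC.2 A hA)), ?_⟩, ?_⟩
      (Set.subset_insert _ _)
    · rw [this]; exact Set.mem_insert _ _
    · rintro T (rfl | hT)
      · exact ⟨hS, hne⟩
      · exact hC.1.2 T hT
    · rintro T (rfl | hT)
      · exact subset_rfl
      · exact hC.2 T hT
  have hfl : IsFlag Pol.lines (C ∪ E) := by
    constructor
    · intro a ha b hb hab
      rcases ha with ha | ha <;> rcases hb with hb | hb
      · exact hC.1.1 ha hb hab
      · exact Or.inl ((hC.2 a ha).trans (hE2 b hb).2.1)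
      · exact Or.inr ((hC.2 b hb).trans (hE2 a ha).2.1)
      · exact hE1 ha hb hab
    · rintro T (hT | hT)
      · exact hC.1.2 T hT
      · exact (hE2 T hT).1
  have hcard := Pol.flag_card (C ∪ E) hfl (by
    intro C' hC' hsub
    refine hsub.antisymm (fun T hT => ?_)
    have hcmp : T ⊆ S ∨ S ⊂ T := by
      by_cases hTS : T ⊆ S
      · exact Or.inl hTS
      · right
        refine ⟨?_, hTS⟩
        rcases S.eq_empty_or_nonempty with h0 | h0
        · rw [h0]; exact Set.empty_subset _
        · rcases hC'.1.total hT (hsub (Or.inl (hSC h0))) with h | h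
          · exact absurd h hTS
          · exact h
    rcases hcmp with h | h
    · left
      rw [hmax (insert T C) ⟨⟨aux_insert_chain hC.1.1
        (fun A hA => hC'.1.total hT (hsub (Or.inl hA))), ?_⟩, ?_⟩ (Set.subset_insert _ _)]
      · exact Set.mem_insert _ _
      · rintro A (rfl | hA)
        · exact hC'.2 A hT
        · exact hC.1.2 A hA
      · rintro A (rfl | hA)
        · exact h
        · exact hC.2 A hA
    · right
      rw [hE3 (insert T E) (aux_insert_chain hE1
        (fun A hA => hC'.1.total hT (hsub (Or.inr hA)))) ?_ (Set.subset_insert _ _)]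
      · exact Set.mem_insert _ _
      · rintro A (rfl | hA)
        · exact ⟨hC'.2 A hT, h⟩
        · exact hE2 A hA)
  have hfin : (C ∪ E).Finite := Set.finite_of_ncard_pos (by omega)
  have hCf := hfin.subset Set.subset_union_left
  have hEf := hfin.subset Set.subset_union_right
  refine ⟨hCf, ?_⟩
  rw [← hcard, Set.ncard_union_eq _ hCf hEf]
  rw [Set.disjoint_left]
  intro T h1 h2
  exact (hE2 T h2).2.2 (hC.2 T h1)

theorem aux_exists_flagIn (Pol : PolarSpace P n) (S : Set P) (C : Set (Set P))
    (hC : IsFlagIn Pol.lines S C) :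
    ∃ D, C ⊆ D ∧ IsFlagIn Pol.lines S D ∧
      ∀ D', IsFlagIn Pol.lines S D' → D ⊆ D' → D = D' := by
  obtain ⟨D, h1, h2, h3, h4⟩ := aux_zorn
    (fun T => (IsSingular Pol.lines T ∧ T.Nonempty) ∧ T ⊆ S) C hC.1.1
    (fun T hT => ⟨hC.1.2 T hT, hC.2 T hT⟩)
  exact ⟨D, h1, ⟨⟨h2, fun T hT => (h3 T hT).1⟩, fun T hT => (h3 T hT).2⟩,
    fun D' hD' => h4 D' hD'.1.1 (fun T hT => ⟨hD'.1.2 T hT, hD'.2 T hT⟩)⟩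

/-- Existence of a rank function. -/
theorem aux_rank (Pol : PolarSpace P n) (hn : 0 < n) :
    ∃ d : Set P → ℕ,
      (∀ S, IsSingular Pol.lines S → ∀ m : ℤ, HasDim Pol.lines S m ↔ (d S : ℤ) = m + 1) ∧
      (∀ S T, IsSingular Pol.lines S → IsSingular Pol.lines T → S ⊂ T → d S < d T) ∧
      (∀ S, IsSingular Pol.lines S → d S ≤ n) := by
  choose u hu using aux_flag_compl Pol hn
  have hex : ∀ S, ∃ D, IsFlagIn Pol.lines S D ∧
      ∀ D', IsFlagIn Pol.lines S D' → D ⊆ D' → D = D' := by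
    intro S
    obtain ⟨D, -, h⟩ := aux_exists_flagIn Pol S ∅ ⟨⟨by simp [IsChain], by simp⟩, by simp⟩
    exact ⟨D, h⟩
  refine ⟨fun S => n - u S, ?_, ?_, ?_⟩
  · intro S hS m
    constructor
    · rintro ⟨-, C, h1, h2, h3, h4⟩
      have := (hu S C h1 hS h2).2
      rw [← h4]
      push_cast
      omega
    · intro h
      obtain ⟨C, h1, h2⟩ := hex S
      have := hu S C h1 hS h2
      refine ⟨hS, C, h1, h2, this.1, ?_⟩
      rw [← h]
      have := this.2
      simp only
      omega
  · intro S T hS hT hST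
    obtain ⟨C, h1, h2⟩ := hex S
    have hT0 : T.Nonempty := by
      obtain ⟨x, hx, -⟩ := Set.exists_of_ssubset hST
      exact ⟨x, hx⟩
    obtain ⟨D, g1, g2, g3⟩ := aux_exists_flagIn Pol T (insert T C) (by
      refine ⟨⟨aux_insert_chain h1.1.1 (fun A hA => Or.inr ((h1.2 A hA).trans hST.1)), ?_⟩, ?_⟩
      · rintro A (rfl | hA)
        · exact ⟨hT, hT0⟩
        · exact h1.1.2 A hA
      · rintro A (rfl | hA)
        · exact subset_rfl
        · exact (h1.2 A hA).trans hST.1)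
    have a1 := hu S C h1 hS h2
    have a2 := hu T D g2 hT g3
    have hTC : T ∉ C := fun h => hST.2 (h1.2 T h)
    have a3 := Set.ncard_le_ncard g1 a2.1
    rw [Set.ncard_insert_of_notMem hTC a1.1] at a3
    simp only
    omega
  · intro S _
    exact Nat.sub_le _ _

/-- No index together with its opposite. -/
def aux_Iso {α : Type*} (σ : α → α) (I : Finset α) : Prop := ∀ i ∈ I, σ i ∉ I

theorem aux_ext {α : Type*} [Fintype α] [DecidableEq α] (σ : α → α) (hinv : ∀ i, σ (σ i) = i)
    (hne : ∀ i, σ i ≠ i) (F : Finset α) (m : ℕ) (hF : F.card + 2 * m ≤ Fintype.card α) :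
    ∀ (e : ℕ) (I : Finset α), aux_Iso σ I → Disjoint I F → I.card + e = m →
      ∃ X, I ⊆ X ∧ aux_Iso σ X ∧ Disjoint X F ∧ X.card = m := by
  intro e
  induction e with
  | zero => exact fun I h1 h2 h3 => ⟨I, subset_rfl, h1, h2, h3⟩
  | succ e ih =>
    intro I h1 h2 h3
    have hlt : ((I ∪ I.image σ) ∪ F).card < Fintype.card α := by
      have a1 := Finset.card_union_le (I ∪ I.image σ) F
      have a2 := Finset.card_union_le I (I.image σ)
      have a3 := Finset.card_image_le (s := I) (f := σ)
      omega
    obtain ⟨x, hx⟩ : ∃ x, x ∉ (I ∪ I.image σ) ∪ F := by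
      by_contra hcon
      push Not at hcon
      rw [Finset.eq_univ_iff_forall.2 hcon] at hlt
      simp at hlt
    simp only [Finset.mem_union, Finset.mem_image, not_or, not_exists, not_and] at hx
    obtain ⟨X, g1, g2, g3, g4⟩ := ih (insert x I) (by
        intro i hi
        rw [Finset.mem_insert] at hi ⊢
        rintro (h | h)
        · rcases hi with rfl | hi
          · exact hne _ h
          · exact hx.1.2 i hi h
        · rcases hi with rfl | hi
          · exact hx.1.2 _ h (hinv _)
          · exact h1 i hi h)
      (by rw [Finset.disjoint_insert_left]; exact ⟨hx.2, h2⟩)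
      (by rw [Finset.card_insert_of_notMem hx.1.1]; omega)
    exact ⟨X, (Finset.subset_insert _ _).trans g1, g2, g3, g4⟩

/-- Separation of complement subsets. -/
theorem aux_sep {α : Type*} [Fintype α] [DecidableEq α] (σ : α → α) (hinv : ∀ i, σ (σ i) = i)
    (hne : ∀ i, σ i ≠ i) (m : ℕ) (hm : 2 ≤ m) (hF : 2 + 2 * m ≤ Fintype.card α)
    (A B : Finset α) (hA : aux_Iso σ A) (hA2 : A.card = 2) (hB2 : B.card = 2) (hAB : A ≠ B) :
    ∃ X, aux_Iso σ X ∧ X.card = m ∧ (∃ a ∈ A, a ∈ X) ∧ (∀ a ∈ A, σ a ∉ X) ∧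
      ∃ b ∈ B, σ b ∈ X := by
  obtain ⟨c, hcB, hcA⟩ : ∃ c ∈ B, c ∉ A := by
    by_contra hcon
    push Not at hcon
    exact hAB (Finset.eq_of_subset_of_card_le hcon (by omega)).symm
  obtain ⟨a, b, hab, hAeq, hc⟩ : ∃ a b, a ≠ b ∧ A = {a, b} ∧ (σ c ∈ A → σ c = a) := by
    obtain ⟨a, b, hab, rfl⟩ := Finset.card_eq_two.1 hA2
    by_cases h : σ c = b
    · exact ⟨b, a, hab.symm, Finset.pair_comm _ _, fun _ => h⟩
    · refine ⟨a, b, hab, rfl, fun h' => ?_⟩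
      simp only [Finset.mem_insert, Finset.mem_singleton] at h'
      tauto
  subst hAeq
  have hba : σ b ≠ a := by
    intro h; exact hA b (by simp) (by simp [h])
  have hab' : σ a ≠ b := by
    intro h; exact hA a (by simp) (by simp [h])
  simp only [Finset.mem_insert, Finset.mem_singleton, not_or] at hcA hc
  have hF2 : ({b, σ b} : Finset α).card + 2 * m ≤ Fintype.card α := by
    have := Finset.card_le_two (a := b) (b := σ b)
    omega
  have hX0 : aux_Iso σ ({a, σ c} : Finset α) := by
    intro i hi
    simp only [Finset.mem_insert, Finset.mem_singleton, not_or] at hi ⊢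
    rcases hi with rfl | rfl
    · refine ⟨hne _, fun h => hcA.1 ?_⟩
      rw [← hinv c, ← h, hinv]
    · rw [hinv]
      exact ⟨hcA.1, fun h => hne _ h.symm⟩
  have hdis : Disjoint ({a, σ c} : Finset α) {b, σ b} := by
    rw [Finset.disjoint_left]
    intro i hi
    simp only [Finset.mem_insert, Finset.mem_singleton, not_or] at hi ⊢
    rcases hi with rfl | rfl
    · exact ⟨hab, hba.symm⟩
    · refine ⟨fun h => ?_, fun h => hcA.2 ?_⟩
      · exact hab ((hc (Or.inr h)).symm.trans h)
      · rw [← hinv c, h, hinv]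
  have hc2 := Finset.card_le_two (a := a) (b := σ c)
  obtain ⟨X, h1, h2, h3, h4⟩ := aux_ext σ hinv hne {b, σ b} m hF2
    (m - ({a, σ c} : Finset α).card) _ hX0 hdis (by omega)
  have haX : a ∈ X := h1 (by simp)
  refine ⟨X, h2, h4, ⟨a, by simp, haX⟩, ?_, c, hcB, h1 (by simp)⟩
  intro i hi
  simp only [Finset.mem_insert, Finset.mem_singleton] at hi
  rcases hi with rfl | rfl
  · exact h2 _ haX
  · intro h
    exact Finset.disjoint_left.1 h3 h (by simp)

/-- The counted family of unordered pairs. -/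
def aux_fam {α : Type*} [Fintype α] [DecidableEq α] (σ : α → α) (I J : Finset α) :
    Finset (Finset α) :=
  (Finset.powersetCard 2 Finset.univ).filter
    (fun A => (∀ a ∈ A, σ a ∉ I ∪ J) ∧ (∃ a ∈ A, a ∈ I) ∧ (∃ a ∈ A, a ∈ J))

theorem aux_choose_arith (c t r q : ℕ)
    (h : c + (2 * q + r).choose 2 + (2 * q + r).choose 2
      = (2 * q + 2 * r + t).choose 2 + (2 * q).choose 2) :
    2 * c + t = t * t + 4 * t * (q + r) + 2 * r * r := by
  have key : ∀ x : ℕ, (2 * (x.choose 2) : ℤ) = x * x - x := by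
    intro x
    induction x with
    | zero => simp
    | succ x ih =>
      rw [Nat.choose_succ_succ' x 1]
      push_cast
      rw [mul_add, ih, Nat.choose_one_right]
      ring
  have k1 := key (2 * q + r)
  have k2 := key (2 * q + 2 * r + t)
  have k3 := key (2 * q)
  zify at h ⊢
  push_cast at k1 k2 k3
  linarith

theorem aux_count {α : Type*} [Fintype α] [DecidableEq α] (σ : α → α) (hinv : ∀ i, σ (σ i) = i)
    (n m : ℕ) (hcard : Fintype.card α = 2 * n)
    (I J : Finset α) (hI : aux_Iso σ I) (hJ : aux_Iso σ J) (hIm : I.card = m) (hJm : J.card = m) :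
    ∃ t r s g : ℕ, t = (I ∩ J).card ∧ t + r + s = m ∧ (s = 0 ↔ aux_Iso σ (I ∪ J)) ∧
      r ≤ g ∧ m + g = n ∧
      2 * (aux_fam σ I J).card + t = t * t + 4 * t * g + 2 * r * r := by
  have hinj : Function.Injective σ := fun a b h => by rw [← hinv a, h, hinv]
  set K : Finset α := Finset.univ.filter (fun a => σ a ∉ I ∪ J) with hK
  have hKc : K.card + (I ∪ J).card = 2 * n := by
    have h1 : ((I ∪ J).image σ).card = (I ∪ J).card := Finset.card_image_of_injective _ hinj
    have h2 : K = ((I ∪ J).image σ)ᶜ := by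
      ext a
      simp only [hK, Finset.mem_filter, Finset.mem_univ, true_and, Finset.mem_compl,
        Finset.mem_image, not_exists, not_and]
      constructor
      · intro h x hx hxa
        apply h
        rw [← hxa, hinv]; exact hx
      · intro h h'
        exact h _ h' (hinv a)
    rw [h2, Finset.card_compl, h1, hcard]
    have := Finset.card_le_univ (I ∪ J)
    omega
  set RI := I.filter (fun i => i ∉ J ∧ σ i ∉ J) with hRI
  set RJ := J.filter (fun i => i ∉ I ∧ σ i ∉ I) with hRJ
  set SI := I.filter (fun i => σ i ∈ J) with hSI
  set SJ := J.filter (fun i => σ i ∈ I) with hSJ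
  have hSS : SI.card = SJ.card := by
    have : SJ = SI.image σ := by
      ext a
      simp only [hSI, hSJ, Finset.mem_filter, Finset.mem_image]
      constructor
      · rintro ⟨h1, h2⟩
        exact ⟨σ a, ⟨h2, by rwa [hinv]⟩, hinv a⟩
      · rintro ⟨x, ⟨h1, h2⟩, rfl⟩
        exact ⟨h2, by rwa [hinv]⟩
    rw [this, Finset.card_image_of_injective _ hinj]
  have hIsplit : (I ∩ J).card + RI.card + SI.card = m := by
    rw [← hIm, ← Finset.card_union_of_disjoint, ← Finset.card_union_of_disjoint]
    · congr 1
      ext a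
      simp only [hRI, hSI, Finset.mem_union, Finset.mem_inter, Finset.mem_filter]
      tauto
    · rw [Finset.disjoint_left]
      intro a
      have := hJ a
      simp only [hRI, hSI, Finset.mem_union, Finset.mem_inter, Finset.mem_filter]
      tauto
    · rw [Finset.disjoint_left]
      intro a
      simp only [hRI, Finset.mem_inter, Finset.mem_filter]
      tauto
  have hJsplit : (I ∩ J).card + RJ.card + SJ.card = m := by
    rw [← hJm, ← Finset.card_union_of_disjoint, ← Finset.card_union_of_disjoint]
    · congr 1
      ext a
      simp only [hRJ, hSJ, Finset.mem_union, Finset.mem_inter, Finset.mem_filter]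
      tauto
    · rw [Finset.disjoint_left]
      intro a
      have := hI a
      simp only [hRJ, hSJ, Finset.mem_union, Finset.mem_inter, Finset.mem_filter]
      tauto
    · rw [Finset.disjoint_left]
      intro a
      simp only [hRJ, Finset.mem_inter, Finset.mem_filter]
      tauto
  have hKI : (K \ I).card + (I ∩ J).card + RI.card = K.card := by
    rw [← Finset.card_union_of_disjoint, ← Finset.card_union_of_disjoint]
    · congr 1
      ext a
      have := hI a
      have := hJ a
      simp only [hRI, hK, Finset.mem_union, Finset.mem_inter, Finset.mem_filter,
        Finset.mem_sdiff, Finset.mem_univ, true_and]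
      tauto
    · rw [Finset.disjoint_left]
      intro a
      simp only [hRI, Finset.mem_union, Finset.mem_inter, Finset.mem_filter, Finset.mem_sdiff]
      tauto
    · rw [Finset.disjoint_left]
      intro a
      simp only [Finset.mem_inter, Finset.mem_sdiff]
      tauto
  have hKJ : (K \ J).card + (I ∩ J).card + RJ.card = K.card := by
    rw [← Finset.card_union_of_disjoint, ← Finset.card_union_of_disjoint]
    · congr 1
      ext a
      have := hI a
      have := hJ a
      simp only [hRJ, hK, Finset.mem_union, Finset.mem_inter, Finset.mem_filter,
        Finset.mem_sdiff, Finset.mem_univ, true_and]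
      tauto
    · rw [Finset.disjoint_left]
      intro a
      simp only [hRJ, Finset.mem_union, Finset.mem_inter, Finset.mem_filter, Finset.mem_sdiff]
      tauto
    · rw [Finset.disjoint_left]
      intro a
      simp only [Finset.mem_inter, Finset.mem_sdiff]
      tauto
  have hKIJ : (K \ (I ∪ J)).card + RJ.card = (K \ I).card := by
    rw [← Finset.card_union_of_disjoint]
    · congr 1
      ext a
      have := hI a
      have := hJ a
      simp only [hRJ, hK, Finset.mem_union, Finset.mem_filter,
        Finset.mem_sdiff, Finset.mem_univ, true_and]
      tauto
    · rw [Finset.disjoint_left]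
      intro a
      simp only [hRJ, Finset.mem_union, Finset.mem_filter, Finset.mem_sdiff]
      tauto
  have hun := Finset.card_union_add_card_inter I J
  have hfam : (aux_fam σ I J).card + (Finset.powersetCard 2 (K \ I)).card
      + (Finset.powersetCard 2 (K \ J)).card
      = (Finset.powersetCard 2 K).card + (Finset.powersetCard 2 (K \ (I ∪ J))).card := by
    have e1 : Finset.powersetCard 2 (K \ I) ∩ Finset.powersetCard 2 (K \ J)
        = Finset.powersetCard 2 (K \ (I ∪ J)) := by
      ext A
      simp only [Finset.mem_inter, Finset.mem_powersetCard, Finset.subset_iff, Finset.mem_sdiff,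
        Finset.mem_union]
      constructor
      · rintro ⟨⟨h1, h2⟩, h3, -⟩
        exact ⟨fun x hx => ⟨(h1 hx).1, fun h => h.elim (h1 hx).2 (h3 hx).2⟩, h2⟩
      · rintro ⟨h1, h2⟩
        exact ⟨⟨fun x hx => ⟨(h1 hx).1, fun h => (h1 hx).2 (Or.inl h)⟩, h2⟩,
          fun x hx => ⟨(h1 hx).1, fun h => (h1 hx).2 (Or.inr h)⟩, h2⟩
    have e2 : aux_fam σ I J ∪ (Finset.powersetCard 2 (K \ I) ∪ Finset.powersetCard 2 (K \ J))
        = Finset.powersetCard 2 K := by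
      ext A
      simp only [aux_fam, Finset.mem_filter, Finset.mem_powersetCard,
        Finset.subset_iff, Finset.mem_sdiff, hK, Finset.mem_univ, true_and, Finset.mem_union]
      constructor
      · rintro (⟨⟨-, h1⟩, h2, -⟩ | ⟨h1, h2⟩ | ⟨h1, h2⟩)
        · exact ⟨fun x hx => h2 x hx, h1⟩
        · exact ⟨fun x hx => (h1 hx).1, h2⟩
        · exact ⟨fun x hx => (h1 hx).1, h2⟩
      · rintro ⟨h1, h2⟩
        by_cases a1 : ∃ a ∈ A, a ∈ I
        · by_cases a2 : ∃ a ∈ A, a ∈ J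
          · exact Or.inl ⟨⟨fun _ _ => trivial, h2⟩, fun x hx => h1 x hx, a1, a2⟩
          · push Not at a2
            exact Or.inr (Or.inr ⟨fun x hx => ⟨h1 x hx, a2 x hx⟩, h2⟩)
        · push Not at a1
          exact Or.inr (Or.inl ⟨fun x hx => ⟨h1 x hx, a1 x hx⟩, h2⟩)
    have e3 : Disjoint (aux_fam σ I J)
        (Finset.powersetCard 2 (K \ I) ∪ Finset.powersetCard 2 (K \ J)) := by
      rw [Finset.disjoint_left]
      intro A hA hA'
      simp only [aux_fam, Finset.mem_filter] at hA
      obtain ⟨-, -, ⟨a, ha, haI⟩, ⟨b, hb, hbJ⟩⟩ := hA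
      rw [Finset.mem_union, Finset.mem_powersetCard, Finset.mem_powersetCard] at hA'
      rcases hA' with h | h
      · exact (Finset.mem_sdiff.1 (h.1 ha)).2 haI
      · exact (Finset.mem_sdiff.1 (h.1 hb)).2 hbJ
    have e4 := Finset.card_union_add_card_inter (Finset.powersetCard 2 (K \ I))
      (Finset.powersetCard 2 (K \ J))
    rw [← e2, Finset.card_union_of_disjoint e3, ← e1]
    omega
  simp only [Finset.card_powersetCard] at hfam
  have hrg : RI.card ≤ n - m ∧ m ≤ n := by omega
  refine ⟨(I ∩ J).card, RI.card, SI.card, n - m, rfl, hIsplit, ?_, hrg.1, by omega, ?_⟩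
  · rw [Finset.card_eq_zero, Finset.filter_eq_empty_iff]
    constructor
    · intro h i hi
      rw [Finset.mem_union] at hi ⊢
      rintro (h' | h')
      · rcases hi with hi | hi
        · exact hI i hi h'
        · exact h h' (by rwa [hinv])
      · rcases hi with hi | hi
        · exact h hi h'
        · exact hJ i hi h'
    · intro h i hi hi'
      exact h i (Finset.mem_union_left _ hi) (Finset.mem_union_right _ hi')
  · obtain ⟨q, hq⟩ : ∃ q, n - m = q + RI.card := ⟨n - m - RI.card, by omega⟩
    rw [hq]
    apply aux_choose_arith
    have i1 : (K \ I).card = 2 * q + RI.card := by omega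
    have i2 : (K \ J).card = 2 * q + RI.card := by omega
    have i3 : K.card = 2 * q + 2 * RI.card + (I ∩ J).card := by omega
    have i4 : (K \ (I ∪ J)).card = 2 * q := by omega
    rw [i1, i2, i3, i4] at hfam
    exact hfam

/-- The extremal estimate. -/
theorem aux_extremal (m g t r s c : ℕ) (hg : 1 ≤ g) (htm : t < m) (hrg : r ≤ g)
    (hsum : t + r + s = m) (hc : 2 * c + t = t * t + 4 * t * g + 2 * r * r) :
    2 * c ≤ (m - 1) * (m - 2) + 4 * (m - 1) * g + 2 ∧
    (2 * c = (m - 1) * (m - 2) + 4 * (m - 1) * g + 2 ↔ t + 1 = m ∧ s = 0) := by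
  obtain ⟨e, rfl⟩ : ∃ e, m = t + 1 + e := ⟨m - (t + 1), by omega⟩
  rcases Nat.eq_zero_or_pos e with rfl | he
  · have e1 : (t + 1 + 0 - 1) = t := by omega
    have e2 : t * (t + 1 + 0 - 2) + t = t * t := by
      rcases t with _ | t
      · simp
      · have : t + 1 + 1 + 0 - 2 = t := by omega
        rw [this]; ring
    rw [e1]
    have hr : r = 0 ∨ r = 1 := by omega
    rcases hr with rfl | rfl
    · refine ⟨by omega, ?_⟩
      constructor
      · intro h; omega
      · rintro ⟨-, h⟩; omega
    · refine ⟨by omega, ?_⟩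
      constructor
      · intro h; omega
      · rintro ⟨-, h⟩; omega
  · have key : 2 * c < (t + 1 + e - 1) * (t + 1 + e - 2) + 4 * (t + 1 + e - 1) * g + 2 := by
      obtain ⟨f, rfl⟩ : ∃ f, e = f + 1 := ⟨e - 1, by omega⟩
      have e1 : t + 1 + (f + 1) - 1 = t + f + 1 := by omega
      have e2 : t + 1 + (f + 1) - 2 = t + f := by omega
      rw [e1, e2]
      have hr2 : r ≤ f + 2 := by omega
      have h1 : r * r ≤ (f + 2) * g := Nat.mul_le_mul hr2 hrg
      nlinarith [Nat.zero_le (f * g), Nat.zero_le (t * f), Nat.zero_le (f * f)]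
    exact ⟨key.le, ⟨fun h => absurd h key.ne, fun h => by omega⟩⟩

section Base

variable (Pol : PolarSpace P n) (p : Fin (2 * n) → P) (σ : Fin (2 * n) → Fin (2 * n))

theorem aux_sigma_ne (hσ : ∀ i j, ¬ Col Pol.lines (p i) (p j) ↔ j = σ i) (i) : σ i ≠ i :=
  fun h => (hσ i i).2 h.symm (Or.inl rfl)

theorem aux_sigma_inv (hσ : ∀ i j, ¬ Col Pol.lines (p i) (p j) ↔ j = σ i) (i) : σ (σ i) = i :=
  ((hσ (σ i) i).1 (fun h => (hσ i (σ i)).2 rfl (aux_col_symm h))).symm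

/-- The span of a set of base points. -/
def aux_Sp (I : Finset (Fin (2 * n))) : Set P := span Pol.lines (p '' (I : Set (Fin (2 * n))))

theorem aux_mem_Sp (hσ : ∀ i j, ¬ Col Pol.lines (p i) (p j) ↔ j = σ i)
    (I : Finset (Fin (2 * n))) (j) : p j ∈ aux_Sp Pol p I ↔ j ∈ I := by
  constructor
  · intro h
    by_contra hj
    have h1 : aux_Sp Pol p I ⊆ {y | Col Pol.lines (p (σ j)) y} := by
      refine aux_span_le (aux_perp_subspace Pol _) ?_
      rintro _ ⟨i, hi, rfl⟩
      by_contra hcon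
      have := (hσ _ _).1 hcon
      rw [aux_sigma_inv Pol p σ hσ] at this
      exact hj (this ▸ hi)
    exact (hσ j (σ j)).2 rfl (aux_col_symm (h1 h))
  · intro h
    exact aux_subset_span _ _ ⟨j, h, rfl⟩

theorem aux_Sp_singular (hσ : ∀ i j, ¬ Col Pol.lines (p i) (p j) ↔ j = σ i)
    (I : Finset (Fin (2 * n))) : IsSingular Pol.lines (aux_Sp Pol p I) ↔ aux_Iso σ I := by
  constructor
  · intro h i hi hi'
    exact (hσ i (σ i)).2 rfl (h.2 _ ((aux_mem_Sp Pol p σ hσ I _).2 hi) _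
      ((aux_mem_Sp Pol p σ hσ I _).2 hi'))
  · intro h
    apply aux_span_singular
    rintro _ ⟨i, hi, rfl⟩ _ ⟨j, hj, rfl⟩
    by_contra hcon
    rw [hσ] at hcon
    exact h i hi (hcon ▸ hj)

theorem aux_Sp_ssub (hσ : ∀ i j, ¬ Col Pol.lines (p i) (p j) ↔ j = σ i)
    {I J : Finset (Fin (2 * n))} (h : I ⊂ J) : aux_Sp Pol p I ⊂ aux_Sp Pol p J := by
  refine ⟨aux_span_mono _ (Set.image_mono (by exact_mod_cast h.1)), fun h' => h.2 ?_⟩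
  intro j hj
  exact (aux_mem_Sp Pol p σ hσ I j).1 (h' ((aux_mem_Sp Pol p σ hσ J j).2 hj))

theorem aux_Sp_dim (hn : 0 < n) (hσ : ∀ i j, ¬ Col Pol.lines (p i) (p j) ↔ j = σ i)
    (I : Finset (Fin (2 * n))) (m : ℤ) :
    HasDim Pol.lines (aux_Sp Pol p I) m ↔ aux_Iso σ I ∧ (I.card : ℤ) = m + 1 := by
  obtain ⟨d, h1, h2, h3⟩ := aux_rank Pol hn
  have lower : ∀ I : Finset (Fin (2 * n)), aux_Iso σ I → I.card ≤ d (aux_Sp Pol p I) := by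
    intro I
    induction I using Finset.induction_on with
    | empty => simp
    | insert a s ha ih =>
      intro h
      have hs : aux_Iso σ s := fun i hi hi' =>
        h i (Finset.mem_insert_of_mem hi) (Finset.mem_insert_of_mem hi')
      have := h2 _ _ ((aux_Sp_singular Pol p σ hσ _).2 hs) ((aux_Sp_singular Pol p σ hσ _).2 h)
        (aux_Sp_ssub Pol p σ hσ (Finset.ssubset_insert ha))
      have := ih hs
      rw [Finset.card_insert_of_notMem ha]
      omega
  have upper : ∀ (e : ℕ) (I : Finset (Fin (2 * n))), aux_Iso σ I → I.card + e = n →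
      d (aux_Sp Pol p I) ≤ I.card := by
    intro e
    induction e with
    | zero =>
      intro I hI hc
      have := h3 _ ((aux_Sp_singular Pol p σ hσ _).2 hI)
      omega
    | succ e ih =>
      intro I hI hc
      obtain ⟨X, g1, g2, -, g4⟩ := aux_ext σ (aux_sigma_inv Pol p σ hσ) (aux_sigma_ne Pol p σ hσ)
        ∅ (I.card + 1) (by simp; omega) 1 I hI (by simp) rfl
      have hss : I ⊂ X := by
        refine g1.ssubset_of_ne ?_
        rintro rfl
        omega
      have a1 := h2 _ _ ((aux_Sp_singular Pol p σ hσ _).2 hI)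
        ((aux_Sp_singular Pol p σ hσ _).2 g2) (aux_Sp_ssub Pol p σ hσ hss)
      have a2 := ih X g2 (by omega)
      omega
  have eq : ∀ I : Finset (Fin (2 * n)), aux_Iso σ I → d (aux_Sp Pol p I) = I.card := by
    intro I hI
    have a1 := lower I hI
    have a2 := h3 _ ((aux_Sp_singular Pol p σ hσ _).2 hI)
    have a3 := upper (n - I.card) I hI (by omega)
    omega
  constructor
  · intro h
    have hI := (aux_Sp_singular Pol p σ hσ _).1 h.1
    refine ⟨hI, ?_⟩
    rw [← eq I hI]
    exact (h1 _ h.1 m).1 h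
  · rintro ⟨hI, hc⟩
    rw [h1 _ ((aux_Sp_singular Pol p σ hσ _).2 hI), eq I hI]
    exact hc

theorem aux_mem_baseSubset (hn : 0 < n) (hσ : ∀ i j, ¬ Col Pol.lines (p i) (p j) ↔ j = σ i)
    (k : ℕ) (S : Set P) : S ∈ baseSubset Pol.lines p (k : ℤ) ↔
      ∃ I : Finset (Fin (2 * n)), aux_Iso σ I ∧ I.card = k + 1 ∧ S = aux_Sp Pol p I := by
  classical
  constructor
  · rintro ⟨h, I, rfl⟩
    have hI : span Pol.lines (p '' I) = aux_Sp Pol p I.toFinset := by simp [aux_Sp]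
    rw [hI] at h ⊢
    have := (aux_Sp_dim Pol p σ hn hσ _ _).1 h
    exact ⟨I.toFinset, this.1, by exact_mod_cast this.2, rfl⟩
  · rintro ⟨I, h1, h2, rfl⟩
    exact ⟨(aux_Sp_dim Pol p σ hn hσ _ _).2 ⟨h1, by exact_mod_cast h2⟩, I, rfl⟩

theorem aux_gcoll (hn : 0 < n) (hσ : ∀ i j, ¬ Col Pol.lines (p i) (p j) ↔ j = σ i)
    (k : ℕ) (I J : Finset (Fin (2 * n))) (hne : aux_Sp Pol p I ≠ aux_Sp Pol p J) :
    GColl Pol.lines (k : ℤ) (aux_Sp Pol p I) (aux_Sp Pol p J) ↔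
      aux_Iso σ (I ∪ J) ∧ (I ∪ J).card = k + 2 := by
  have hsp : span Pol.lines (aux_Sp Pol p I ∪ aux_Sp Pol p J) = aux_Sp Pol p (I ∪ J) := by
    apply Set.Subset.antisymm
    · refine aux_span_le (aux_span_subspace _ _) (Set.union_subset ?_ ?_)
      · exact aux_span_mono _ (Set.image_mono (by simp))
      · exact aux_span_mono _ (Set.image_mono (by simp))
    · refine aux_span_mono _ ?_
      rintro _ ⟨i, hi, rfl⟩
      rcases Finset.mem_union.1 (Finset.mem_coe.1 hi) with h | h
      · exact Or.inl ((aux_mem_Sp Pol p σ hσ _ _).2 h)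
      · exact Or.inr ((aux_mem_Sp Pol p σ hσ _ _).2 h)
  unfold GColl
  rw [hsp]
  have hd := aux_Sp_dim Pol p σ hn hσ (I ∪ J) (k + 1)
  constructor
  · rintro ⟨-, -, h⟩
    have := hd.1 h
    exact ⟨this.1, by have := this.2; omega⟩
  · rintro ⟨h1, h2⟩
    refine ⟨hne, ?_, hd.2 ⟨h1, by omega⟩⟩
    intro a ha b hb
    refine ((aux_Sp_singular Pol p σ hσ _).2 h1).2 a ?_ b ?_
    · rw [← hsp]; exact aux_subset_span _ _ (Or.inl ha)
    · rw [← hsp]; exact aux_subset_span _ _ (Or.inr hb)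

theorem aux_cCount (hn : 0 < n) (hσ : ∀ i j, ¬ Col Pol.lines (p i) (p j) ↔ j = σ i)
    (k : ℕ) (hk1 : 1 ≤ k) (hk2 : k + 2 ≤ n) (I J : Finset (Fin (2 * n)))
    (hI : aux_Iso σ I) (hIc : I.card = k + 1) (hJ : aux_Iso σ J) (hJc : J.card = k + 1) :
    cCount Pol.lines p σ (k : ℤ) (aux_Sp Pol p I) (aux_Sp Pol p J) = (aux_fam σ I J).card := by
  classical
  have hinv := aux_sigma_inv Pol p σ hσ
  have hsne := aux_sigma_ne Pol p σ hσ
  have hmem := aux_mem_Sp Pol p σ hσ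
  have hbase := aux_mem_baseSubset Pol p σ hn hσ k
  set D : Finset (Fin (2 * n)) → Set (Set P) := fun A =>
    {X | X ∈ baseSubset Pol.lines p (k : ℤ) ∧ (∃ a ∈ A, p a ∈ X) ∧ ∀ a ∈ A, p (σ a) ∉ X} with hD
  have hCD : ∀ i j, Cij Pol.lines p σ k i j = D {i, σ j} := by
    intro i j
    ext X
    simp only [hD, Cij, plus, minus, Set.mem_union, Set.mem_inter_iff, Set.mem_setOf_eq,
      Finset.mem_insert, Finset.mem_singleton, forall_eq_or_imp, forall_eq, exists_eq_or_imp,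
      exists_eq_left, hinv]
    by_cases hX : X ∈ baseSubset Pol.lines p (k : ℤ)
    · obtain ⟨Y, hY, -, rfl⟩ := (hbase X).1 hX
      simp only [hX, hmem, true_and]
      have a1 := hY i
      have a2 := hY j
      tauto
    · simp only [hX, false_and, or_false]
  have hDm : ∀ A Y, aux_Iso σ Y → Y.card = k + 1 →
      (aux_Sp Pol p Y ∈ D A ↔ (∃ a ∈ A, a ∈ Y) ∧ ∀ a ∈ A, σ a ∉ Y) := by
    intro A Y h1 h2
    have : aux_Sp Pol p Y ∈ baseSubset Pol.lines p (k : ℤ) := (hbase _).2 ⟨Y, h1, h2, rfl⟩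
    simp only [hD, Set.mem_setOf_eq, this, true_and, hmem]
  have hfiso : ∀ A ∈ aux_fam σ I J, aux_Iso σ A ∧ A.card = 2 := by
    intro A hA
    simp only [aux_fam, Finset.mem_filter, Finset.mem_powersetCard, Finset.mem_union, not_or] at hA
    obtain ⟨⟨-, h2⟩, h3, ⟨a, ha, haI⟩, ⟨b, hb, hbJ⟩⟩ := hA
    refine ⟨?_, h2⟩
    intro i hi hi'
    have e1 : ({i, σ i} : Finset (Fin (2 * n))) = A := by
      apply Finset.eq_of_subset_of_card_le
      · intro x hx
        simp only [Finset.mem_insert, Finset.mem_singleton] at hx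
        rcases hx with rfl | rfl <;> assumption
      · rw [Finset.card_pair (hsne i).symm]; omega
    rw [← e1] at ha
    simp only [Finset.mem_insert, Finset.mem_singleton] at ha
    rcases ha with rfl | rfl
    · have := (h3 _ hi').1
      rw [hinv] at this
      exact this haI
    · exact (h3 _ hi).1 haI
  have hset : {R : Set (Set P) | (∃ i j, j ≠ i ∧ j ≠ σ i ∧ R = Cij Pol.lines p σ k i j) ∧
      aux_Sp Pol p I ∈ R ∧ aux_Sp Pol p J ∈ R} = D '' (aux_fam σ I J : Set _) := by
    ext R
    constructor
    · rintro ⟨⟨i, j, h1, h2, rfl⟩, h3, h4⟩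
      rw [hCD] at h3 h4 ⊢
      rw [hDm _ _ hI hIc] at h3
      rw [hDm _ _ hJ hJc] at h4
      refine ⟨_, ?_, rfl⟩
      simp only [aux_fam, Finset.mem_coe, Finset.mem_filter, Finset.mem_powersetCard,
        Finset.mem_union, not_or]
      refine ⟨⟨Finset.subset_univ _, Finset.card_pair ?_⟩,
        fun a ha => ⟨h3.2 a ha, h4.2 a ha⟩, h3.1, h4.1⟩
      intro h
      apply h2
      rw [h, hinv]
    · rintro ⟨A, hA, rfl⟩
      have hA' := hfiso A hA
      simp only [aux_fam, Finset.mem_coe, Finset.mem_filter, Finset.mem_powersetCard,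
        Finset.mem_union, not_or] at hA
      obtain ⟨-, h3, h4, h5⟩ := hA
      refine ⟨?_, (hDm _ _ hI hIc).2 ⟨h4, fun a ha => (h3 a ha).1⟩,
        (hDm _ _ hJ hJc).2 ⟨h5, fun a ha => (h3 a ha).2⟩⟩
      obtain ⟨a, b, hab, rfl⟩ := Finset.card_eq_two.1 hA'.2
      refine ⟨a, σ b, ?_, ?_, ?_⟩
      · intro h
        exact hA'.1 b (by simp) (by simp [h])
      · intro h
        apply hab
        rw [← hinv a, ← h, hinv]
      · rw [hCD, hinv]
  unfold cCount
  rw [hset, Set.ncard_image_of_injOn, Set.ncard_coe_finset]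
  intro A hA B hB hAB
  by_contra hne
  have hA' := hfiso A hA
  have hB' := hfiso B hB
  obtain ⟨X, x1, x2, x3, x4, b, hb, hbX⟩ := aux_sep σ hinv hsne (k + 1) (by omega)
    (by simp; omega) A B hA'.1 hA'.2 hB'.2 hne
  have : aux_Sp Pol p X ∈ D A := (hDm _ _ x1 x2).2 ⟨x3, x4⟩
  have hAB' : D A = D B := hAB
  rw [hAB', hDm _ _ x1 x2] at this
  exact this.2 b hb hbX

end Base

end Helpers

/-- Lemma 9: distinct `S, U` in a base subset of `G_k` are collinear points
of `𝔊_k` iff `c(S,U)` attains the maximal value `m_c`. -/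
theorem collinear_iff_cCount_max
    {P : Type*} {n : ℕ} (Pol : PolarSpace P n) (hn : 3 ≤ n)
    (hCD : TypeC Pol.lines n ∨ TypeD Pol.lines n)
    (k : ℕ) (hk1 : 1 ≤ k) (hk2 : k ≤ n - 2)
    (p : Fin (2 * n) → P) (hp : IsBase Pol.lines p)
    (σ : Fin (2 * n) → Fin (2 * n))
    (hσ : ∀ i j, ¬ Col Pol.lines (p i) (p j) ↔ j = σ i)
    (S U : Set P)
    (hS : S ∈ baseSubset Pol.lines p (k : ℤ))
    (hU : U ∈ baseSubset Pol.lines p (k : ℤ)) (hSU : S ≠ U) :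
    GColl Pol.lines (k : ℤ) S U ↔
      cCount Pol.lines p σ (k : ℤ) S U =
        sSup {c : ℕ | ∃ S' ∈ baseSubset Pol.lines p (k : ℤ),
          ∃ U' ∈ baseSubset Pol.lines p (k : ℤ),
            S' ≠ U' ∧ c = cCount Pol.lines p σ (k : ℤ) S' U'} := by
  classical
  have hn0 : 0 < n := by omega
  have hinv := aux_sigma_inv Pol p σ hσ
  have hsne := aux_sigma_ne Pol p σ hσ
  set M : ℕ := k * (k - 1) + 4 * k * (n - (k + 1)) + 2 with hM
  -- the value of `c` compared with the extremal one
  have main : ∀ I J : Finset (Fin (2 * n)), aux_Iso σ I → I.card = k + 1 → aux_Iso σ J →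
      J.card = k + 1 → aux_Sp Pol p I ≠ aux_Sp Pol p J →
      2 * cCount Pol.lines p σ (k : ℤ) (aux_Sp Pol p I) (aux_Sp Pol p J) ≤ M ∧
      (2 * cCount Pol.lines p σ (k : ℤ) (aux_Sp Pol p I) (aux_Sp Pol p J) = M ↔
        GColl Pol.lines (k : ℤ) (aux_Sp Pol p I) (aux_Sp Pol p J)) := by
    intro I J hI hIc hJ hJc hne
    obtain ⟨t, r, s, g, ht, hsum, hs, hrg, hmg, hc⟩ :=
      aux_count σ hinv n (k + 1) (by simp) I J hI hJ hIc hJc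
    have htm : t < k + 1 := by
      rw [ht, ← hIc]
      apply Finset.card_lt_card
      refine Finset.inter_subset_left.ssubset_of_ne (fun h => hne ?_)
      rw [Finset.eq_of_subset_of_card_le (Finset.inter_eq_left.1 h) (by omega)]
    have hg : n - (k + 1) = g := by omega
    have hext := aux_extremal (k + 1) g t r s _ (by omega) htm hrg hsum hc
    have e1 : k + 1 - 1 = k := by omega
    have e2 : k + 1 - 2 = k - 1 := by omega
    rw [e1, e2, ← hg, ← hM] at hext
    rw [aux_cCount Pol p σ hn0 hσ k hk1 (by omega) I J hI hIc hJ hJc,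
      aux_gcoll Pol p σ hn0 hσ k I J hne, hext.2, hs]
    refine ⟨hext.1, ?_⟩
    have hun := Finset.card_union_add_card_inter I J
    constructor
    · rintro ⟨h1, h2⟩
      exact ⟨h2, by omega⟩
    · rintro ⟨h1, h2⟩
      exact ⟨by omega, h1⟩
  have hbase := aux_mem_baseSubset Pol p σ hn0 hσ k
  -- a collinear pair exists
  obtain ⟨S₀, hS₀, U₀, hU₀, hne₀, hc₀⟩ : ∃ S' ∈ baseSubset Pol.lines p (k : ℤ),
      ∃ U' ∈ baseSubset Pol.lines p (k : ℤ), S' ≠ U' ∧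
        2 * cCount Pol.lines p σ (k : ℤ) S' U' = M := by
    obtain ⟨X, -, hX, -, hXc⟩ := aux_ext σ hinv hsne ∅ (k + 2) (by simp; omega) (k + 2) ∅
      (by intro i hi; simp at hi) (by simp) (by simp)
    obtain ⟨a, ha, b, hb, hab⟩ := Finset.one_lt_card.1 (show 1 < X.card by omega)
    have hiso : ∀ x, aux_Iso σ (X.erase x) := fun x i hi hi' =>
      hX i (Finset.mem_of_mem_erase hi) (Finset.mem_of_mem_erase hi')
    have hca : (X.erase a).card = k + 1 := by rw [Finset.card_erase_of_mem ha]; omega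
    have hcb : (X.erase b).card = k + 1 := by rw [Finset.card_erase_of_mem hb]; omega
    have hne : aux_Sp Pol p (X.erase a) ≠ aux_Sp Pol p (X.erase b) := by
      intro h
      have h1 : p a ∈ aux_Sp Pol p (X.erase b) :=
        (aux_mem_Sp Pol p σ hσ _ _).2 (Finset.mem_erase.2 ⟨hab, ha⟩)
      rw [← h, aux_mem_Sp Pol p σ hσ] at h1
      simp at h1
    have hu : X.erase a ∪ X.erase b = X := by
      ext x
      simp only [Finset.mem_union, Finset.mem_erase]
      constructor
      · rintro (h | h) <;> exact h.2
      · intro h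
        by_cases hx : x = a
        · right; exact ⟨hx ▸ hab, h⟩
        · left; exact ⟨hx, h⟩
    refine ⟨_, (hbase _).2 ⟨_, hiso a, hca, rfl⟩, _, (hbase _).2 ⟨_, hiso b, hcb, rfl⟩, hne, ?_⟩
    rw [(main _ _ (hiso a) hca (hiso b) hcb hne).2, aux_gcoll Pol p σ hn0 hσ k _ _ hne, hu]
    exact ⟨hX, hXc⟩
  have hsup : IsGreatest {c : ℕ | ∃ S' ∈ baseSubset Pol.lines p (k : ℤ),
          ∃ U' ∈ baseSubset Pol.lines p (k : ℤ),
            S' ≠ U' ∧ c = cCount Pol.lines p σ (k : ℤ) S' U'}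
      (cCount Pol.lines p σ (k : ℤ) S₀ U₀) := by
    refine ⟨⟨S₀, hS₀, U₀, hU₀, hne₀, rfl⟩, ?_⟩
    rintro c ⟨S', hS', U', hU', hne, rfl⟩
    obtain ⟨I, hI, hIc, rfl⟩ := (hbase _).1 hS'
    obtain ⟨J, hJ, hJc, rfl⟩ := (hbase _).1 hU'
    have := (main I J hI hIc hJ hJc hne).1
    omega
  rw [hsup.csSup_eq]
  obtain ⟨I, hI, hIc, rfl⟩ := (hbase _).1 hS
  obtain ⟨J, hJ, hJc, rfl⟩ := (hbase _).1 hU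
  rw [← (main I J hI hIc hJ hJc hSU).2, ← hc₀]
  omega
end
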